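/- Let f : (ZMod 2)^n → ZMod 2 be a Boolean function with at least 2 essential variables. Then the arity gap of f equals 2 if and only if f, as a function over the two-element field, is of one of the following special forms for some constant c ∈ {0,1} and distinct indices: f = x_{i_1} + x_{i_2} + ⋯ + x_{i_m} + c (a sum of m ≥ 2 distinct variables plus a constant), f = x_i x_j + x_i + c, f = x_i x_j + x_i x_k + x_j x_k + c, or f = x_i x_j + x_i x_k + x_j x_k + x_i + x_j + c. -/

import Mathlib

/-- The `i`-th variable is essential in `f`. -/
def Essential {A B : Type*} {n : ℕ} (f : (Fin n → A) → B) (i : Fin n) : Prop :=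
  ∃ (a : Fin n → A) (b : A), f a ≠ f (Function.update a i b)

/-- The essential arity of `f`: the number of essential variables. -/
noncomputable def essArity {A B : Type*} {n : ℕ} (f : (Fin n → A) → B) : ℕ :=
  Set.ncard {i : Fin n | Essential f i}

/-- The variable identification minor `f_{i←j}`, substituting `x j` for `x i`. -/
def idMinor {A B : Type*} {n : ℕ} (f : (Fin n → A) → B) (i j : Fin n) :
    (Fin n → A) → B :=
  fun x => f (Function.update x i (x j))

/-- The arity gap of `f`:
`ess f − max { ess f_{i←j} : i ≠ j, x_i and x_j essential in f }`. -/
noncomputable def arityGap {A B : Type*} {n : ℕ} (f : (Fin n → A) → B) : ℕ :=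
  essArity f -
    sSup {m : ℕ | ∃ i j : Fin n, i ≠ j ∧ Essential f i ∧ Essential f j ∧
      m = essArity (idMinor f i j)}

open Function in
theorem ess_iff {B : Type*} {n : ℕ} (f : (Fin n → ZMod 2) → B) (k : Fin n) :
    Essential f k ↔ ∃ x y : Fin n → ZMod 2, (∀ t, t ≠ k → x t = y t) ∧ f x ≠ f y := by
  constructor
  · rintro ⟨a, b, h⟩
    exact ⟨a, update a k b, fun t ht => by simp [ht], h⟩
  · rintro ⟨x, y, h, hne⟩
    refine ⟨x, y k, ?_⟩
    have : update x k (y k) = y := by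
      funext t
      by_cases ht : t = k
      · subst ht; simp
      · simp [ht, h t ht]
    rwa [this]

theorem not_ess {B : Type*} {n : ℕ} {f : (Fin n → ZMod 2) → B} {k : Fin n}
    (h : ¬ Essential f k) (x y : Fin n → ZMod 2) (hxy : ∀ t, t ≠ k → x t = y t) : f x = f y := by
  by_contra hne
  exact h ((ess_iff f k).2 ⟨x, y, hxy, hne⟩)

theorem agree {B : Type*} {n : ℕ} (f : (Fin n → ZMod 2) → B) (x y : Fin n → ZMod 2)
    (h : ∀ t, Essential f t → x t = y t) : f x = f y := by
  have key : ∀ T : Finset (Fin n), f (fun t => if t ∈ T then x t else y t) = f y := by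
    intro T
    induction T using Finset.induction_on with
    | empty => simp
    | insert a T ha ih =>
      rw [← ih]
      by_cases he : Essential f a
      · congr 1
        funext t
        have := h a he
        by_cases hta : t = a
        · subst hta; simp [ha, this]
        · simp [hta]
      · apply not_ess he
        intro t ht
        simp [ht]
  have := key Finset.univ
  simpa using this

def Arr {n : ℕ} (f : (Fin n → ZMod 2) → ZMod 2) (k i j : Fin n) : Prop :=
  ∀ x y : Fin n → ZMod 2, (∀ t, t ≠ k → x t = y t) → x i = x j → f x = f y

def Bb {n : ℕ} (f : (Fin n → ZMod 2) → ZMod 2) (i j : Fin n) : Prop :=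
  ∀ x y : Fin n → ZMod 2, (∀ t, t ≠ i → t ≠ j → x t = y t) → x i = x j → y i = y j → f x = f y

def HH {n : ℕ} (f : (Fin n → ZMod 2) → ZMod 2) : Prop :=
  ∀ i j, i ≠ j → Essential f i → Essential f j →
    Bb f i j ∨ ∃ k, Essential f k ∧ k ≠ i ∧ k ≠ j ∧ Arr f k i j

theorem z2 (a b c : ZMod 2) : a = b ∨ a = c ∨ b = c := by
  revert a b c; decide

theorem Arr.symm {n : ℕ} {f : (Fin n → ZMod 2) → ZMod 2} {k i j : Fin n} (h : Arr f k i j) :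
    Arr f k j i := fun x y hxy e => h x y hxy e.symm

theorem Bb.symm {n : ℕ} {f : (Fin n → ZMod 2) → ZMod 2} {i j : Fin n} (h : Bb f i j) :
    Bb f j i := fun x y hxy e e' => h x y (fun t h1 h2 => hxy t h2 h1) e.symm e'.symm

open Function in
theorem Arr.trans {n : ℕ} {f : (Fin n → ZMod 2) → ZMod 2} {a b c d : Fin n}
    (h1 : Arr f a b c) (h2 : Arr f d b a) (hab : a ≠ b) (hac : a ≠ c) (hda : d ≠ a) (hdb : d ≠ b)
    (hdc : d ≠ c) : Arr f d b c := by
  intro x y hxy e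
  have e1 : f x = f (update x a (x b)) := h1 _ _ (by grind [update_apply]) (by grind [update_apply])
  have e2 : f y = f (update y a (x b)) := h1 _ _ (by grind [update_apply]) (by grind [update_apply])
  have e3 : f (update x a (x b)) = f (update y a (x b)) :=
    h2 _ _ (by grind [update_apply]) (by grind [update_apply])
  rw [e1, e2, e3]

open Function in
/-- Case C. -/
theorem caseC {n : ℕ} {f : (Fin n → ZMod 2) → ZMod 2} {i j k : Fin n}
    (hij : i ≠ j) (hik : i ≠ k) (hjk : j ≠ k) (hk : Essential f k)
    (h1 : Arr f k i j) (h2 : Arr f j i k) (h3 : Bb f j k) : False := by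
  obtain ⟨x, y, hxy, hne⟩ := (ess_iff f k).1 hk
  have e0 : x i ≠ x j := fun e => hne (h1 x y hxy e)
  have key : ∀ z : Fin n → ZMod 2, (∀ t, t ≠ k → x t = z t) →
      f z = f (update (update x j (x i)) k (x i)) := by
    intro z hz
    by_cases hc : z i = z k
    · exact h2 _ _ (by grind [update_apply]) hc
    · have := z2 (z i) (z j) (z k)
      exact h3 _ _ (by grind [update_apply]) (by grind) (by grind [update_apply])
  exact hne ((key x (by grind)).trans (key y hxy).symm)

open Function in
theorem caseD {n : ℕ} {f : (Fin n → ZMod 2) → ZMod 2} (H : HH f) {i j k m : Fin n}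
    (hij : i ≠ j) (hik : i ≠ k) (hjk : j ≠ k) (him : i ≠ m) (hjm : j ≠ m) (hkm : k ≠ m)
    (hi : Essential f i) (hj : Essential f j) (hk : Essential f k) (hm : Essential f m)
    (h1 : Arr f k i j) (h2 : Arr f m i k) : False := by
  have h3 : Arr f m i j := h1.trans h2 hik.symm hjk.symm hkm.symm him.symm hjm.symm
  obtain ⟨x, y, hxy, hne⟩ := (ess_iff f m).1 hm
  have a1 : x i ≠ x j := fun e => hne (h3 x y hxy e)
  have a2 : x i ≠ x k := fun e => hne (h2 x y hxy e)
  have a3 : x j = x k := by have := z2 (x i) (x j) (x k); grind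
  rcases H j k hjk hj hk with hB | ⟨l, hl, hlj, hlk, hA⟩
  · have e1 : f x = f (update (update x j (x i)) k (x i)) :=
      hB _ _ (by grind [update_apply]) (by grind [update_apply]) (by grind [update_apply])
    have e2 : f y = f (update (update y j (x i)) k (x i)) :=
      hB _ _ (by grind [update_apply]) (by grind [update_apply]) (by grind [update_apply])
    have e3 : f (update (update x j (x i)) k (x i)) = f (update (update y j (x i)) k (x i)) :=
      h2 _ _ (by grind [update_apply]) (by grind [update_apply])
    grind
  by_cases hli : l = i
  · subst hli
    have e1 : f x = f (update x l (x j)) := hA _ _ (by grind [update_apply]) (by grind)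
    have e2 : f y = f (update y l (x j)) := hA _ _ (by grind [update_apply]) (by grind)
    have e3 : f (update x l (x j)) = f (update y l (x j)) :=
      h2 _ _ (by grind [update_apply]) (by grind [update_apply])
    grind
  by_cases hlm : l = m
  · subst hlm
    exact hne (hA x y hxy a3)
  have hA2 : Arr f l j i := h1.symm.trans hA hjk.symm hik.symm hlk hlj hli
  -- points with coordinate l synchronised with m
  have b1 : f x = f (update x l (x m)) := hA _ _ (by grind [update_apply]) (by grind)
  have b2 : f y = f (update y l (y m)) := hA _ _ (by grind [update_apply]) (by grind)
  have h45 : Arr f k m l := by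
    rcases H m l (Ne.symm hlm) hm hl with hB | ⟨p, hp, hpm, hpl, hC⟩
    · have e3 : f (update x l (x m)) = f (update y l (y m)) :=
        hB _ _ (by grind [update_apply]) (by grind [update_apply]) (by grind [update_apply])
      grind
    by_cases hpi : p = i
    · subst hpi
      have e1 : f (update x l (x m)) = f (update (update x l (x m)) p (x j)) :=
        hC _ _ (by grind [update_apply]) (by grind [update_apply])
      have e2 : f (update y l (y m)) = f (update (update y l (y m)) p (x j)) :=
        hC _ _ (by grind [update_apply]) (by grind [update_apply])
      have e3 : f (update (update x l (x m)) p (x j)) = f (update (update x l (y m)) p (x j)) :=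
        hA2 _ _ (by grind [update_apply]) (by grind [update_apply])
      have e4 : f (update (update x l (y m)) p (x j)) = f (update (update y l (y m)) p (x j)) :=
        h3 _ _ (by grind [update_apply]) (by grind [update_apply])
      grind
    by_cases hpj : p = j
    · subst hpj
      have e1 : f (update x l (x m)) = f (update (update x l (x m)) p (x i)) :=
        hC _ _ (by grind [update_apply]) (by grind [update_apply])
      have e2 : f (update y l (y m)) = f (update (update y l (y m)) p (x i)) :=
        hC _ _ (by grind [update_apply]) (by grind [update_apply])
      have e3 : f (update (update x l (x m)) p (x i)) = f (update (update x l (y m)) p (x i)) :=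
        hA2 _ _ (by grind [update_apply]) (by grind [update_apply])
      have e4 : f (update (update x l (y m)) p (x i)) = f (update (update y l (y m)) p (x i)) :=
        h3 _ _ (by grind [update_apply]) (by grind [update_apply])
      grind
    by_cases hpk : p = k
    · subst hpk; exact hC
    exfalso
    obtain ⟨u, v, huv, hne'⟩ := (ess_iff f p).1 hp
    apply hne'
    by_cases hu : u i = u j
    · have e1 : f u = f (update u m (u l)) := h3 _ _ (by grind [update_apply]) (by grind)
      have e2 : f v = f (update v m (u l)) := h3 _ _ (by grind [update_apply]) (by grind)
      have e3 : f (update u m (u l)) = f (update v m (u l)) :=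
        hC _ _ (by grind [update_apply]) (by grind [update_apply])
      grind
    by_cases hu2 : u i = u k
    · have e1 : f u = f (update u m (u l)) := h2 _ _ (by grind [update_apply]) (by grind)
      have e2 : f v = f (update v m (u l)) := h2 _ _ (by grind [update_apply]) (by grind)
      have e3 : f (update u m (u l)) = f (update v m (u l)) :=
        hC _ _ (by grind [update_apply]) (by grind [update_apply])
      grind
    have hu3 : u j = u k := by have := z2 (u i) (u j) (u k); grind
    have e1 : f u = f (update u l (u m)) := hA _ _ (by grind [update_apply]) (by grind)
    have e2 : f v = f (update v l (u m)) := hA _ _ (by grind [update_apply]) (by grind)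
    have e3 : f (update u l (u m)) = f (update v l (u m)) :=
      hC _ _ (by grind [update_apply]) (by grind [update_apply])
    grind
  clear b1 b2
  obtain ⟨u, v, huv, hne'⟩ := (ess_iff f l).1 hl
  have c1 : u j ≠ u k := fun e => hne' (hA u v huv e)
  have c2 : u j ≠ u i := fun e => hne' (hA2 u v huv e)
  have c3 : u i = u k := by have := z2 (u i) (u j) (u k); grind
  have d1 : f u = f (update u m (u k)) := h2 _ _ (by grind [update_apply]) (by grind)
  have d2 : f v = f (update v m (u k)) := h2 _ _ (by grind [update_apply]) (by grind)
  rcases H k m hkm hk hm with hB | ⟨p, hp, hpk, hpm, hC⟩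
  · have e1 : f (update u m (u k)) = f (update (update u m (u j)) k (u j)) :=
      hB _ _ (by grind [update_apply]) (by grind [update_apply]) (by grind [update_apply])
    have e2 : f (update v m (u k)) = f (update (update v m (u j)) k (u j)) :=
      hB _ _ (by grind [update_apply]) (by grind [update_apply]) (by grind [update_apply])
    have e3 : f (update (update u m (u j)) k (u j)) = f (update (update v m (u j)) k (u j)) :=
      hA _ _ (by grind [update_apply]) (by grind [update_apply])
    grind
  by_cases hpi : p = i
  · subst hpi
    have e1 : f (update u m (u k)) = f (update (update u m (u k)) p (u j)) :=
      hC _ _ (by grind [update_apply]) (by grind [update_apply])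
    have e2 : f (update v m (u k)) = f (update (update v m (u k)) p (u j)) :=
      hC _ _ (by grind [update_apply]) (by grind [update_apply])
    have e3 : f (update (update u m (u k)) p (u j)) = f (update (update v m (u k)) p (u j)) :=
      hA2 _ _ (by grind [update_apply]) (by grind [update_apply])
    grind
  by_cases hpj : p = j
  · subst hpj
    have e1 : f (update u m (u k)) = f (update (update u m (u k)) p (u i)) :=
      hC _ _ (by grind [update_apply]) (by grind [update_apply])
    have e2 : f (update v m (u k)) = f (update (update v m (u k)) p (u i)) :=
      hC _ _ (by grind [update_apply]) (by grind [update_apply])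
    have e3 : f (update (update u m (u k)) p (u i)) = f (update (update v m (u k)) p (u i)) :=
      hA2 _ _ (by grind [update_apply]) (by grind [update_apply])
    grind
  by_cases hpl : p = l
  · subst hpl
    have e1 : f (update u m (u k)) = f (update v m (u k)) :=
      hC _ _ (by grind [update_apply]) (by grind [update_apply])
    grind
  have g1 : Arr f p k i := h2.symm.trans hC hkm.symm him.symm hpm hpk hpi
  have g2 : Arr f p i j := h1.trans g1.symm hik.symm hjk.symm hpk hpi hpj
  obtain ⟨r, s, hrs, hne2⟩ := (ess_iff f p).1 hp
  have k1 : r i ≠ r j := fun e => hne2 (g2 r s hrs e)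
  have k2 : r k ≠ r i := fun e => hne2 (g1 r s hrs e)
  have k3 : r j = r k := by have := z2 (r i) (r j) (r k); grind
  have e1 : f r = f (update r l (r m)) := hA _ _ (by grind [update_apply]) (by grind)
  have e2 : f s = f (update s l (r m)) := hA _ _ (by grind [update_apply]) (by grind)
  have e3 : f (update r l (r m)) = f (update (update r l (r m)) k (r m)) :=
    h45 _ _ (by grind [update_apply]) (by grind [update_apply])
  have e4 : f (update s l (r m)) = f (update (update s l (r m)) k (r m)) :=
    h45 _ _ (by grind [update_apply]) (by grind [update_apply])
  have e5 : f (update (update r l (r m)) k (r m)) = f (update (update s l (r m)) k (r m)) :=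
    hC _ _ (by grind [update_apply]) (by grind [update_apply])
  grind

/-- Twisted majority. -/
def Mj (s a b c : ZMod 2) : ZMod 2 := a * b + a * (c + s) + b * (c + s)

theorem Mj_diag (s a c : ZMod 2) : Mj s a a c = a := by
  revert s a c; decide
theorem Mj_p1 (s a c : ZMod 2) : Mj s a (c + s + 1) c = a := by
  revert s a c; decide
theorem Mj_p2 (s a c : ZMod 2) : Mj s (c + s + 1) a c = a := by
  revert s a c; decide
theorem Mj_p3 (s a c : ZMod 2) : Mj s a (c + s + 1) (c + 1) = c + s + 1 := by
  revert s a c; decide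

theorem Mj1_cases (a b c : ZMod 2) : (a = b ∧ Mj 1 a b c = a) ∨ (a ≠ b ∧ a = c ∧ Mj 1 a b c = b) ∨
    (a ≠ b ∧ b = c ∧ Mj 1 a b c = a) := by
  revert a b c; decide
theorem Mj0_cases (a b c : ZMod 2) : (a = b ∧ Mj 0 a b c = a) ∨ (a ≠ b ∧ a = c ∧ Mj 0 a b c = a) ∨
    (a ≠ b ∧ b = c ∧ Mj 0 a b c = b) := by
  revert a b c; decide

def MM {n : ℕ} (f : (Fin n → ZMod 2) → ZMod 2) (s : ZMod 2) (i j k : Fin n) : Prop :=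
  ∀ x y : Fin n → ZMod 2, (∀ t, t ≠ i → t ≠ j → t ≠ k → x t = y t) →
    Mj s (x i) (x j) (x k) = Mj s (y i) (y j) (y k) → f x = f y

open Function in
theorem MM_of {n : ℕ} {f : (Fin n → ZMod 2) → ZMod 2} {s : ZMod 2} {i j k : Fin n}
    (h : ∀ x : Fin n → ZMod 2, f x = f (fun t => if t = i ∨ t = j ∨ t = k then
      Mj s (x i) (x j) (x k) else x t)) : MM f s i j k := by
  intro x y hxy e
  rw [h x, h y, e]
  congr 1
  funext t
  grind

open Function in
theorem caseA {n : ℕ} {f : (Fin n → ZMod 2) → ZMod 2} {i j k : Fin n}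
    (hij : i ≠ j) (hik : i ≠ k) (hjk : j ≠ k)
    (h1 : Arr f k i j) (h2 : Bb f i k) (h3 : Bb f j k) : MM f 1 i j k := by
  apply MM_of
  intro x
  rcases Mj1_cases (x i) (x j) (x k) with ⟨e, e'⟩ | ⟨e, e1, e'⟩ | ⟨e, e1, e'⟩
  · exact h1 _ _ (by grind) (by grind)
  · exact h2 _ _ (by grind) (by grind) (by grind)
  · exact h3 _ _ (by grind) (by grind) (by grind)

theorem caseB {n : ℕ} {f : (Fin n → ZMod 2) → ZMod 2} {i j k : Fin n}
    (hij : i ≠ j) (hik : i ≠ k) (hjk : j ≠ k)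
    (h1 : Arr f k i j) (h2 : Arr f j i k) (h3 : Arr f i j k) : MM f 0 i j k := by
  apply MM_of
  intro x
  rcases Mj0_cases (x i) (x j) (x k) with ⟨e, e'⟩ | ⟨e, e1, e'⟩ | ⟨e, e1, e'⟩
  · exact h1 _ _ (by grind) (by grind)
  · exact h2 _ _ (by grind) (by grind)
  · exact h3 _ _ (by grind) (by grind)

open Function in
theorem noFourth {n : ℕ} {f : (Fin n → ZMod 2) → ZMod 2} (H : HH f) {i j k m : Fin n}
    (hij : i ≠ j) (hik : i ≠ k) (hjk : j ≠ k) (him : i ≠ m) (hjm : j ≠ m) (hkm : k ≠ m)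
    (hk : Essential f k) (hm : Essential f m) (s : ZMod 2) (h : MM f s i j k) : False := by
  obtain ⟨x, y, hxy, hne⟩ := (ess_iff f k).1 hk
  set a := Mj s (x i) (x j) (x k) with ha
  set b := Mj s (y i) (y j) (y k) with hb
  have p1 := Mj_p1 s
  have p2 := Mj_p2 s
  have p3 := Mj_p3 s
  have p0 := Mj_diag s
  have q1 : f x = f (update (update (update x i a) j (x m + s + 1)) k (x m)) :=
    h _ _ (by grind [update_apply]) (by grind [update_apply])
  have q2 : f y = f (update (update (update x i b) j (x m + s + 1)) k (x m)) :=
    h _ _ (by grind [update_apply]) (by grind [update_apply])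
  rcases H k m hkm hk hm with hB | ⟨p, hp, hpk, hpm, hC⟩
  · have e1 : f (update (update (update x i a) j (x m + s + 1)) k (x m)) =
        f (update (update (update (update x i a) j (x m + s + 1)) k (x m + 1)) m (x m + 1)) :=
      hB _ _ (by grind [update_apply]) (by grind [update_apply]) (by grind [update_apply])
    have e2 : f (update (update (update x i b) j (x m + s + 1)) k (x m)) =
        f (update (update (update (update x i b) j (x m + s + 1)) k (x m + 1)) m (x m + 1)) :=
      hB _ _ (by grind [update_apply]) (by grind [update_apply]) (by grind [update_apply])
    have e3 : f (update (update (update (update x i a) j (x m + s + 1)) k (x m + 1)) m (x m + 1)) =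
        f (update (update (update (update x i b) j (x m + s + 1)) k (x m + 1)) m (x m + 1)) :=
      h _ _ (by grind [update_apply]) (by
        have t1 := p3 a (x m)
        have t2 := p3 b (x m)
        grind [update_apply])
    grind
  by_cases hpi : p = i
  · subst hpi
    have e1 : f (update (update (update x p a) j (x m + s + 1)) k (x m)) =
       f (update (update (update x p b) j (x m + s + 1)) k (x m)) :=
      hC _ _ (by grind [update_apply]) (by grind [update_apply])
    grind
  by_cases hpj : p = j
  · subst hpj
    have r1 : f x = f (update (update (update x i (x m + s + 1)) p a) k (x m)) :=
      h _ _ (by grind [update_apply]) (by grind [update_apply])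
    have r2 : f y = f (update (update (update x i (x m + s + 1)) p b) k (x m)) :=
      h _ _ (by grind [update_apply]) (by grind [update_apply])
    have e1 : f (update (update (update x i (x m + s + 1)) p a) k (x m)) =
        f (update (update (update x i (x m + s + 1)) p b) k (x m)) :=
      hC _ _ (by grind [update_apply]) (by grind [update_apply])
    grind
  obtain ⟨u, v, huv, hne'⟩ := (ess_iff f p).1 hp
  have huv3 : Mj s (u i) (u j) (u k) = Mj s (v i) (v j) (v k) := by
    rw [huv i (Ne.symm hpi), huv j (Ne.symm hpj), huv k (Ne.symm hpk)]
  set c := Mj s (u i) (u j) (u k) with hc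
  have r1 : f u = f (update (update (update u i c) j c) k (u m)) :=
      h _ _ (by grind [update_apply]) (by grind [update_apply])
  have r2 : f v = f (update (update (update v i c) j c) k (u m)) :=
      h _ _ (by grind [update_apply]) (by grind [update_apply])
  have e1 : f (update (update (update u i c) j c) k (u m)) =
      f (update (update (update v i c) j c) k (u m)) :=
    hC _ _ (by grind [update_apply]) (by grind [update_apply])
  grind

theorem formM {n : ℕ} {f : (Fin n → ZMod 2) → ZMod 2} {i j k : Fin n}
    (hk : Essential f k) (hess : ∀ t, Essential f t → t = i ∨ t = j ∨ t = k)
    (s : ZMod 2) (h : MM f s i j k) : ∃ c, ∀ x, f x = Mj s (x i) (x j) (x k) + c := by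
  have h' : ∀ x y : Fin n → ZMod 2, Mj s (x i) (x j) (x k) = Mj s (y i) (y j) (y k) → f x = f y := by
    intro x y e
    have e1 : f x = f (fun t => if t = i ∨ t = j ∨ t = k then x t else y t) :=
      agree f _ _ (fun t ht => by simp [hess t ht])
    rw [e1]
    exact h _ _ (by grind) (by simpa using e)
  obtain ⟨u, v, huv, hne⟩ := (ess_iff f k).1 hk
  have hM : Mj s (u i) (u j) (u k) ≠ Mj s (v i) (v j) (v k) := fun e => hne (h' u v e)
  refine ⟨f u + Mj s (u i) (u j) (u k), fun x => ?_⟩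
  have z : ∀ p q r a b c : ZMod 2, a ≠ b → p ≠ q → (c = a → r = p) → (c = b → r = q) →
    r = c + (p + a) := by decide
  exact z _ (f v) _ _ _ _ hM hne (h' x u) (h' x v)

def PInv {n : ℕ} (f : (Fin n → ZMod 2) → ZMod 2) (i j : Fin n) : Prop :=
  ∀ x y : Fin n → ZMod 2, (∀ t, t ≠ i → t ≠ j → x t = y t) → x i + x j = y i + y j → f x = f y

open Function in
theorem inv_of {n : ℕ} {f : (Fin n → ZMod 2) → ZMod 2} {i j k : Fin n}
    (hij : i ≠ j) (hik : i ≠ k) (hjk : j ≠ k) (h1 : Bb f i j) (h2 : Bb f i k) (h3 : Bb f j k) :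
    PInv f i j := by
  intro x y hxy e
  by_cases hx : x i = x j
  · exact h1 x y hxy hx (by revert hx e; generalize x i = a, x j = b, y i = c, y j = d; revert a b c d; decide)
  by_cases hy : x i = y i
  · have : x = y := by
      funext t
      by_cases ht : t = i
      · rw [ht, hy]
      by_cases ht' : t = j
      · rw [ht']; rw [hy] at e; exact add_left_cancel e
      exact hxy t ht ht'
    rw [this]
  have hs : y i = x j ∧ y j = x i := by
    revert hx hy e; generalize x i = a, x j = b, y i = c, y j = d; revert a b c d; decide
  by_cases hk : x k = x i
  · have e1 : f x = f (update (update x i (x j)) k (x j)) :=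
      h2 _ _ (by grind [update_apply]) (by grind [update_apply]) (by grind [update_apply])
    have e2 : f (update (update x i (x j)) k (x j)) = f y :=
      h3 _ _ (by grind [update_apply]) (by grind [update_apply]) (by grind [update_apply])
    rw [e1, e2]
  · have hk' : x k = x j := by have := z2 (x k) (x i) (x j); grind
    have e1 : f x = f (update (update x j (x i)) k (x i)) :=
      h3 _ _ (by grind [update_apply]) (by grind [update_apply]) (by grind [update_apply])
    have e2 : f (update (update x j (x i)) k (x i)) = f y :=
      h2 _ _ (by grind [update_apply]) (by grind [update_apply]) (by grind [update_apply])
    rw [e1, e2]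

open Function in
theorem linear_of {n : ℕ} {f : (Fin n → ZMod 2) → ZMod 2}
    (h : ∀ i j, i ≠ j → Essential f i → Essential f j → PInv f i j) (S : Finset (Fin n))
    (hS : ∀ i, i ∈ S ↔ Essential f i) : ∃ c, ∀ x, f x = (∑ i ∈ S, x i) + c := by
  have zz : ∀ a : ZMod 2, a + 1 + 1 = a := by decide
  have z1 : ∀ b c : ZMod 2, ¬ b = c → b = c + 1 := by decide
  have z4 : ∀ p q r w : ZMod 2, p ≠ q → p + (r + w) = q + (r + 1 + w) := by decide
  have key : ∀ k, Essential f k → ∀ x : Fin n → ZMod 2, f x ≠ f (update x k (x k + 1)) := by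
    intro k hk
    obtain ⟨u, v, huv, hne⟩ := (ess_iff f k).1 hk
    have hv : v = update u k (u k + 1) := by
      funext t
      by_cases ht : t = k
      · subst ht
        have : u t ≠ v t := by
          intro e
          apply hne
          congr 1
          funext r
          by_cases hr : r = t
          · rw [hr, e]
          · exact huv r hr
        revert this
        simp only [update_self]
        generalize u t = a, v t = b
        revert a b; decide
      · simp [ht, huv t ht]
    intro x
    have := agree (fun x : Fin n → ZMod 2 => f x = f (update x k (x k + 1))) x u (by
      intro t ht
      exfalso
      obtain ⟨a, b, hab⟩ := ht
      apply hab
      by_cases hb : b = a t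
      · subst hb; simp
      have hb : b = a t + 1 := by
        exact z1 _ _ hb
      subst hb
      by_cases htk : t = k
      · subst htk
        simp [zz, eq_comm]
      by_cases het : Essential f t
      · have e1 : f (update a t (a t + 1)) = f (update a k (a k + 1)) :=
          h t k htk het hk _ _ (by grind [update_apply]) (by grind [update_apply])
        have e2 : f (update (update a t (a t + 1)) k (a k + 1)) = f a :=
          h t k htk het hk _ _ (by grind [update_apply]) (by
            have : ∀ a b : ZMod 2, (a + 1) + (b + 1) = a + b := by decide
            grind [update_apply])
        simp only [update_of_ne (Ne.symm htk)]
        rw [e1, e2]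
        exact propext eq_comm
      · have e1 : f (update a t (a t + 1)) = f a := not_ess het _ _ (by grind [update_apply])
        have e2 : f (update (update a t (a t + 1)) k (a k + 1)) = f (update a k (a k + 1)) :=
          not_ess het _ _ (by grind [update_apply])
        simp only [update_of_ne (Ne.symm htk)]
        rw [e1, e2])
    intro e
    have e' := this.mp e
    rw [← hv] at e'
    exact hne e'
  have hc : ∀ x, f x + ∑ i ∈ S, x i = f 0 + ∑ i ∈ S, (0 : Fin n → ZMod 2) i := by
    intro x
    refine agree (fun x => f x + ∑ i ∈ S, x i) x 0 ?_
    intro t ht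
    exfalso
    obtain ⟨a, b, hab⟩ := ht
    apply hab
    by_cases hb : b = a t
    · subst hb; simp
    have hb : b = a t + 1 := by
      exact z1 _ _ hb
    subst hb
    by_cases het : Essential f t
    · have := key t het a
      have htS := (hS t).2 het
      simp only [Finset.sum_update_of_mem htS]
      rw [← Finset.add_sum_erase S a htS, Finset.sdiff_singleton_eq_erase]
      exact z4 _ _ _ _ this
    · have htS : t ∉ S := fun h => het ((hS t).1 h)
      simp only [Finset.sum_update_of_notMem htS]
      rw [not_ess het a (update a t (a t + 1)) (by grind [update_apply])]
  refine ⟨f 0, fun x => ?_⟩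
  have := hc x
  simp only [Pi.zero_apply, Finset.sum_const_zero, add_zero] at this
  rw [← this]
  have : ∀ a b : ZMod 2, a = b + (a + b) := by decide
  exact this _ _

theorem form2 {n : ℕ} {f : (Fin n → ZMod 2) → ZMod 2} {i j : Fin n} (hij : i ≠ j)
    (hi : Essential f i) (hess : ∀ t, Essential f t → t = i ∨ t = j) (hB : Bb f i j) :
    ∃ c, (∀ x, f x = x i + x j + c) ∨ (∀ x, f x = x i * x j + x i + c) ∨
      (∀ x, f x = x j * x i + x j + c) := by
  let F : ZMod 2 → ZMod 2 → ZMod 2 := fun a b => f (fun t => if t = i then a else if t = j then b else 0)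
  have hF : ∀ x, f x = F (x i) (x j) := by
    intro x
    apply agree
    intro t ht
    rcases hess t ht with rfl | rfl
    · simp
    · simp [Ne.symm hij]
  have h01 : F 0 0 = F 1 1 := hB _ _ (by grind) (by simp) (by simp)
  obtain ⟨u, v, huv, hne⟩ := (ess_iff f i).1 hi
  rw [hF u, hF v] at hne
  simp only [hF]
  clear_value F
  have : ∀ F : ZMod 2 → ZMod 2 → ZMod 2, F 0 0 = F 1 1 → (∃ a b c d, F a b ≠ F c d) → 
    ∃ c, (∀ a b, F a b = a + b + c) ∨ (∀ a b, F a b = a * b + a + c) ∨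
      (∀ a b, F a b = b * a + b + c) := by decide
  obtain ⟨c, h⟩ := this F h01 ⟨_, _, _, _, hne⟩
  refine ⟨c, ?_⟩
  rcases h with h | h | h
  · exact Or.inl fun x => h _ _
  · exact Or.inr (Or.inl fun x => h _ _)
  · exact Or.inr (Or.inr fun x => h _ _)

def Forms {n : ℕ} (f : (Fin n → ZMod 2) → ZMod 2) : Prop :=
      ((∃ (S : Finset (Fin n)) (c : ZMod 2), 2 ≤ S.card ∧
          ∀ x : Fin n → ZMod 2, f x = (∑ i ∈ S, x i) + c) ∨
       (∃ (i j : Fin n) (c : ZMod 2), i ≠ j ∧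
          ∀ x : Fin n → ZMod 2, f x = x i * x j + x i + c) ∨
       (∃ (i j k : Fin n) (c : ZMod 2), i ≠ j ∧ i ≠ k ∧ j ≠ k ∧
          ∀ x : Fin n → ZMod 2, f x = x i * x j + x i * x k + x j * x k + c) ∨
       (∃ (i j k : Fin n) (c : ZMod 2), i ≠ j ∧ i ≠ k ∧ j ≠ k ∧
          ∀ x : Fin n → ZMod 2,
            f x = x i * x j + x i * x k + x j * x k + x i + x j + c))

theorem forward {n : ℕ} (f : (Fin n → ZMod 2) → ZMod 2) (H : HH f) (hf : 2 ≤ essArity f) :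
    Forms f := by
  classical
  obtain ⟨i0, hi0, j0, hj0, hij0⟩ := (Set.one_lt_ncard (Set.toFinite _)).1 hf
  simp only [Set.mem_setOf_eq] at hi0 hj0
  by_cases hall : ∀ i j, i ≠ j → Essential f i → Essential f j → Bb f i j
  · by_cases h3 : ∃ k, Essential f k ∧ k ≠ i0 ∧ k ≠ j0
    · obtain ⟨k0, hk0, hki, hkj⟩ := h3
      have hinv : ∀ i j, i ≠ j → Essential f i → Essential f j → PInv f i j := by
        intro i j hij hi hj
        have : ∃ k, Essential f k ∧ k ≠ i ∧ k ≠ j := by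
          by_cases h1 : i0 ≠ i ∧ i0 ≠ j
          · exact ⟨i0, hi0, h1⟩
          by_cases h2 : j0 ≠ i ∧ j0 ≠ j
          · exact ⟨j0, hj0, h2⟩
          refine ⟨k0, hk0, ?_, ?_⟩ <;> grind
        obtain ⟨k, hk, h1, h2⟩ := this
        exact inv_of hij h1.symm h2.symm (hall i j hij hi hj) (hall i k h1.symm hi hk)
          (hall j k h2.symm hj hk)
      let S : Finset (Fin n) := Finset.univ.filter (fun t => Essential f t)
      obtain ⟨c, hc⟩ := linear_of hinv S (by simp [S])
      refine Or.inl ⟨S, c, ?_, hc⟩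
      exact Finset.one_lt_card.2 ⟨i0, by simp [S, hi0], j0, by simp [S, hj0], hij0⟩
    · push Not at h3
      obtain ⟨c, h⟩ := form2 hij0 hi0 (fun t ht => by have := h3 t ht; tauto) (hall i0 j0 hij0 hi0 hj0)
      rcases h with h | h | h
      · refine Or.inl ⟨{i0, j0}, c, by simp [hij0], fun x => ?_⟩
        rw [h x, Finset.sum_pair hij0]
      · exact Or.inr (Or.inl ⟨i0, j0, c, hij0, h⟩)
      · exact Or.inr (Or.inl ⟨j0, i0, c, hij0.symm, h⟩)
  · push Not at hall
    obtain ⟨i, j, hij, hi, hj, hnB⟩ := hall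
    rcases H i j hij hi hj with hB | ⟨k, hk, hki, hkj, hA⟩
    · exact absurd hB hnB
    have fin : ∀ s, MM f s i j k → ∃ c, ∀ x, f x = Mj s (x i) (x j) (x k) + c := by
      intro s hM
      apply formM hk _ s hM
      intro t ht
      by_contra hcon
      push Not at hcon
      exact noFourth H hij hki.symm hkj.symm (Ne.symm hcon.1) (Ne.symm hcon.2.1)
        (Ne.symm hcon.2.2) hk ht s hM
    rcases H i k hki.symm hi hk with hB1 | ⟨p, hp, hpi, hpk, hA1⟩
    · rcases H j k hkj.symm hj hk with hB2 | ⟨q, hq, hqj, hqk, hA2⟩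
      · obtain ⟨c, hc⟩ := fin 1 (caseA hij hki.symm hkj.symm hA hB1 hB2)
        refine Or.inr (Or.inr (Or.inr ⟨i, j, k, c, hij, hki.symm, hkj.symm, fun x => ?_⟩))
        rw [hc x, Mj]; ring
      · exfalso
        by_cases hqi : q = i
        · subst hqi
          exact caseC hij.symm hkj.symm hki.symm hk hA.symm hA2 hB1
        · exact caseD H hij.symm hkj.symm hki.symm (Ne.symm hqj) (Ne.symm hqi) (Ne.symm hqk)
            hj hi hk hq hA.symm hA2
    · by_cases hpj : p = j
      · subst hpj
        rcases H p k hkj.symm hj hk with hB2 | ⟨q, hq, hqj, hqk, hA2⟩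
        · exact (caseC hij hki.symm hkj.symm hk hA hA1 hB2).elim
        · by_cases hqi : q = i
          · subst hqi
            obtain ⟨c, hc⟩ := fin 0 (caseB hij hki.symm hkj.symm hA hA1 hA2)
            refine Or.inr (Or.inr (Or.inl ⟨q, p, k, c, hij, hki.symm, hkj.symm, fun x => ?_⟩))
            rw [hc x, Mj]; ring
          · exact (caseD H hij.symm hkj.symm hki.symm (Ne.symm hqj) (Ne.symm hqi) (Ne.symm hqk)
              hj hi hk hq hA.symm hA2).elim
      · exact (caseD H hij hki.symm hkj.symm (Ne.symm hpi) (Ne.symm hpj) (Ne.symm hpk)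
          hi hj hk hp hA hA1).elim

open Function in
theorem ess_minor {n : ℕ} {f : (Fin n → ZMod 2) → ZMod 2} {i j : Fin n} (hij : i ≠ j)
    (hj : Essential f j) :
    {t | Essential (idMinor f i j) t} ⊆ {t | Essential f t} \ {i} := by
  intro t ht
  simp only [Set.mem_setOf_eq, Set.mem_diff, Set.mem_singleton_iff] at *
  obtain ⟨x, y, hxy, hne⟩ := (ess_iff _ t).1 ht
  simp only [idMinor] at hne
  constructor
  · by_cases htj : t = j
    · rwa [htj]
    by_contra hn
    exact hne (not_ess hn _ _ (by grind [update_apply]))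
  · rintro rfl
    apply hne
    congr 1
    grind

theorem bdd {n : ℕ} (f : (Fin n → ZMod 2) → ZMod 2) : 
    BddAbove {m : ℕ | ∃ i j : Fin n, i ≠ j ∧ Essential f i ∧ Essential f j ∧
      m = essArity (idMinor f i j)} := by
  refine ⟨essArity f, ?_⟩
  rintro m ⟨i, j, hij, hi, hj, rfl⟩
  exact Set.ncard_le_ncard ((ess_minor hij hj).trans Set.diff_subset) (Set.toFinite _)

open Function in
theorem HH_of_gap {n : ℕ} (f : (Fin n → ZMod 2) → ZMod 2)  (hg : arityGap f = 2) : HH f := by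
  intro i j hij hi hj
  by_contra hcon
  push Not at hcon
  obtain ⟨hB, hA⟩ := hcon
  have hle := le_csSup (bdd f) ⟨i, j, hij, hi, hj, rfl⟩
  have hsub : {t | Essential f t} \ {i} ⊆ {t | Essential (idMinor f i j) t} := by
    rintro t ⟨ht, hti⟩
    simp only [Set.mem_setOf_eq, Set.mem_singleton_iff] at *
    rw [ess_iff]
    by_cases htj : t = j
    · subst htj
      unfold Bb at hB
      push Not at hB
      obtain ⟨x, y, hxy, hx, hy, hne⟩ := hB
      refine ⟨update x i 0, update y i 0, by grind [update_apply], ?_⟩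
      have e1 : update (update x i 0) i (update x i 0 t) = x := by
        funext r; grind [update_apply]
      have e2 : update (update y i 0) i (update y i 0 t) = y := by
        funext r; grind [update_apply]
      simpa only [idMinor, e1, e2] using hne
    · have := hA t ht hti htj
      unfold Arr at this
      push Not at this
      obtain ⟨x, y, hxy, hx, hne⟩ := this
      refine ⟨x, y, hxy, ?_⟩
      have e1 : update x i (x j) = x := by
        funext r; grind [update_apply]
      have e2 : update y i (y j) = y := by
        funext r; grind [update_apply]
      simpa only [idMinor, e1, e2] using hne
  have h1 := Set.ncard_le_ncard hsub (Set.toFinite _)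
  rw [Set.ncard_diff_singleton_of_mem (show i ∈ {t | Essential f t} from hi)] at h1
  unfold arityGap at hg
  unfold essArity at *
  omega

open Function in
theorem lin_ess {n : ℕ} {g : (Fin n → ZMod 2) → ZMod 2} {S : Finset (Fin n)} {c : ZMod 2}
    (h : ∀ x, g x = (∑ i ∈ S, x i) + c) : {t | Essential g t} = S := by
  ext t
  simp only [Set.mem_setOf_eq, Finset.mem_coe]
  constructor
  · rintro ⟨a, b, hne⟩
    by_contra ht
    apply hne
    rw [h, h, Finset.sum_update_of_notMem ht]
  · intro ht
    refine ⟨0, 1, ?_⟩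
    rw [h, h, Finset.sum_update_of_mem ht]
    simp

theorem lin_arity {n : ℕ} {g : (Fin n → ZMod 2) → ZMod 2} {S : Finset (Fin n)} {c : ZMod 2}
    (h : ∀ x, g x = (∑ i ∈ S, x i) + c) : essArity g = S.card := by
  rw [essArity, lin_ess h, Set.ncard_coe_finset]

theorem gap_of {n : ℕ} (f : (Fin n → ZMod 2) → ZMod 2) (hf : 2 ≤ essArity f)
    (h : ∀ i j, i ≠ j → Essential f i → Essential f j → essArity (idMinor f i j) + 2 = essArity f) :
    arityGap f = 2 := by
  obtain ⟨i0, hi0, j0, hj0, hij0⟩ := (Set.one_lt_ncard (Set.toFinite _)).1 hf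
  have : {m : ℕ | ∃ i j : Fin n, i ≠ j ∧ Essential f i ∧ Essential f j ∧
      m = essArity (idMinor f i j)} = {essArity f - 2} := by
    ext m
    simp only [Set.mem_setOf_eq, Set.mem_singleton_iff]
    constructor
    · rintro ⟨i, j, hij, hi, hj, rfl⟩
      have := h i j hij hi hj
      omega
    · rintro rfl
      refine ⟨i0, j0, hij0, hi0, hj0, ?_⟩
      have := h i0 j0 hij0 hi0 hj0
      omega
  rw [arityGap, this, csSup_singleton]
  omega

open Function in
theorem tern {n : ℕ} (f : (Fin n → ZMod 2) → ZMod 2) (hf : 2 ≤ essArity f) (s : ZMod 2)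
    {i j k : Fin n} {c : ZMod 2} (hij : i ≠ j) (hik : i ≠ k) (hjk : j ≠ k)
    (h : ∀ x, f x = Mj s (x i) (x j) (x k) + c) : arityGap f = 2 := by
  have D1 : ∀ s, ¬ Mj s 0 (s + 1) 0 = Mj s 1 (s + 1) 0 := by decide
  have D2 : ∀ s, ¬ Mj s (s + 1) 0 0 = Mj s (s + 1) 1 0 := by decide
  have D3 : ∀ s, ¬ Mj s 1 0 0 = Mj s 1 0 1 := by decide
  have hE : {t | Essential f t} = (({i, j, k} : Finset (Fin n)) : Set (Fin n)) := by
    ext t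
    simp only [Set.mem_setOf_eq, Finset.coe_insert, Finset.coe_singleton, Set.mem_insert_iff,
      Set.mem_singleton_iff]
    constructor
    · rintro ⟨a, b, hne⟩
      by_contra hcon
      push Not at hcon
      apply hne
      rw [h, h]
      simp [Ne.symm hcon.1, Ne.symm hcon.2.1, Ne.symm hcon.2.2]
    · rintro (rfl | rfl | rfl)
      · refine ⟨update 0 j (s + 1), 1, ?_⟩
        rw [h, h]
        simp [hij, hik, hjk, Ne.symm hij, Ne.symm hik, Ne.symm hjk]
        exact D1 s
      · refine ⟨update 0 i (s + 1), 1, ?_⟩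
        rw [h, h]
        simp [hij, hik, hjk, Ne.symm hij, Ne.symm hik, Ne.symm hjk]
        exact D2 s
      · refine ⟨update 0 i 1, 1, ?_⟩
        rw [h, h]
        simp [hij, hik, hjk, Ne.symm hij, Ne.symm hik, Ne.symm hjk]
        exact D3 s
  have hN : essArity f = 3 := by
    rw [essArity, hE, Set.ncard_coe_finset]
    exact Finset.card_eq_three.2 ⟨i, j, k, hij, hik, hjk, rfl⟩
  have m1 : ∀ s a b, Mj s a a b = a := by decide
  have m2 : ∀ s a b, Mj s a b a = if s = 0 then a else b := by decide
  have m3 : ∀ s a b, Mj s b a a = if s = 0 then a else b := by decide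
  apply gap_of f hf
  intro p q hpq hp hq
  have hp' : p ∈ {t | Essential f t} := hp
  have hq' : q ∈ {t | Essential f t} := hq
  rw [hE] at hp' hq'
  simp only [Finset.coe_insert, Finset.coe_singleton, Set.mem_insert_iff,
      Set.mem_singleton_iff] at hp' hq'
  rw [hN]
  have : ∃ r, ∀ x, idMinor f p q x = (∑ t ∈ ({r} : Finset (Fin n)), x t) + c := by
    simp only [idMinor, h, Finset.sum_singleton]
    by_cases hs : s = 0
    · refine ⟨q, fun x => ?_⟩
      rcases hp' with rfl | rfl | rfl <;> rcases hq' with rfl | rfl | rfl <;>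
        simp_all [Ne.symm hij, Ne.symm hik, Ne.symm hjk]
    · rcases hp' with rfl | rfl | rfl <;> rcases hq' with rfl | rfl | rfl <;>
        first
        | exact absurd rfl hpq
        | (refine ⟨i, fun x => ?_⟩; simp_all [Ne.symm hij, Ne.symm hik, Ne.symm hjk]; done)
        | (refine ⟨j, fun x => ?_⟩; simp_all [Ne.symm hij, Ne.symm hik, Ne.symm hjk]; done)
        | (refine ⟨k, fun x => ?_⟩; simp_all [Ne.symm hij, Ne.symm hik, Ne.symm hjk]; done)
        | (refine ⟨p, fun x => ?_⟩; simp_all [Ne.symm hij, Ne.symm hik, Ne.symm hjk]; done)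
        | (refine ⟨q, fun x => ?_⟩; simp_all [Ne.symm hij, Ne.symm hik, Ne.symm hjk]; done)
  obtain ⟨r, hr⟩ := this
  rw [lin_arity hr]
  simp

open Function in
theorem backward {n : ℕ} (f : (Fin n → ZMod 2) → ZMod 2) (hf : 2 ≤ essArity f) (h : Forms f) :
    arityGap f = 2 := by
  have two : ∀ a : ZMod 2, a + a = 0 := by decide
  rcases h with ⟨S, c, hS, h⟩ | ⟨i, j, c, hij, h⟩ | ⟨i, j, k, c, hij, hik, hjk, h⟩ |
    ⟨i, j, k, c, hij, hik, hjk, h⟩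
  · apply gap_of f hf
    intro p q hpq hp hq
    have hE := lin_ess h
    have hp : p ∈ S := by
      have : p ∈ {t | Essential f t} := hp
      rwa [hE] at this
    have hq : q ∈ S := by
      have : q ∈ {t | Essential f t} := hq
      rwa [hE] at this
    have hq' : q ∈ S.erase p := Finset.mem_erase.2 ⟨hpq.symm, hq⟩
    have hm : ∀ x, idMinor f p q x = (∑ t ∈ (S.erase p).erase q, x t) + c := by
      intro x
      rw [idMinor, h, Finset.sum_update_of_mem hp, Finset.sdiff_singleton_eq_erase,
        ← Finset.add_sum_erase _ _ hq', ← add_assoc, two, zero_add]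
    rw [lin_arity hm, lin_arity h, Finset.card_erase_of_mem hq', Finset.card_erase_of_mem hp]
    omega
  · have hE : {t | Essential f t} ⊆ (({i, j} : Finset (Fin n)) : Set (Fin n)) := by
      intro t ht
      simp only [Finset.coe_insert, Finset.coe_singleton, Set.mem_insert_iff,
        Set.mem_singleton_iff]
      obtain ⟨a, b, hne⟩ := ht
      by_contra hcon
      push Not at hcon
      apply hne
      rw [h, h]
      simp [Ne.symm hcon.1, Ne.symm hcon.2]
    have hN : essArity f ≤ 2 := by
      have := Set.ncard_le_ncard hE (Finset.finite_toSet _)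
      rwa [Set.ncard_coe_finset, Finset.card_pair hij] at this
    apply gap_of f hf
    intro p q hpq hp hq
    have hp' := hE hp
    have hq' := hE hq
    simp only [Finset.coe_insert, Finset.coe_singleton, Set.mem_insert_iff,
        Set.mem_singleton_iff] at hp' hq'
    have hm : ∀ x, idMinor f p q x = (∑ t ∈ (∅ : Finset (Fin n)), x t) + c := by
      intro x
      have z : ∀ a : ZMod 2, a * a + a = 0 := by decide
      rw [idMinor, h]
      rcases hp' with rfl | rfl <;> rcases hq' with rfl | rfl <;>
        first
        | exact absurd rfl hpq
        | simp [hpq, Ne.symm hpq, z]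
    rw [lin_arity hm, Finset.card_empty]
    omega
  · exact tern f hf 0 hij hik hjk (c := c) (fun x => by rw [h x, Mj]; ring)
  · exact tern f hf 1 hij hik hjk (c := c) (fun x => by rw [h x, Mj]; ring)

/-- Characterization of Boolean functions of arity gap `2`: a Boolean function with at
least two essential variables has arity gap `2` iff it has one of the four special forms. -/
theorem stmt_6 {n : ℕ} (f : (Fin n → ZMod 2) → ZMod 2) (hf : 2 ≤ essArity f) :
    arityGap f = 2 ↔
      ((∃ (S : Finset (Fin n)) (c : ZMod 2), 2 ≤ S.card ∧
          ∀ x : Fin n → ZMod 2, f x = (∑ i ∈ S, x i) + c) ∨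
       (∃ (i j : Fin n) (c : ZMod 2), i ≠ j ∧
          ∀ x : Fin n → ZMod 2, f x = x i * x j + x i + c) ∨
       (∃ (i j k : Fin n) (c : ZMod 2), i ≠ j ∧ i ≠ k ∧ j ≠ k ∧
          ∀ x : Fin n → ZMod 2, f x = x i * x j + x i * x k + x j * x k + c) ∨
       (∃ (i j k : Fin n) (c : ZMod 2), i ≠ j ∧ i ≠ k ∧ j ≠ k ∧
          ∀ x : Fin n → ZMod 2,
            f x = x i * x j + x i * x k + x j * x k + x i + x j + c)) := by
  exact ⟨fun h => forward f (HH_of_gap f h) hf, fun h => backward f hf h⟩
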